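/- arXiv:2411.07293 — 8 statements merged into one kernel-verified Lean document; each statement's English description precedes it below -/
import Mathlib

section
/- Let 2 ≤ k ≤ n−2 and let π_1,…,π_d ∈ ℝ^(C(n,k)) be tropical Plücker vectors such that π_i + π_j is a tropical Plücker vector for all i, j ∈ [d]. Then for all nonnegative real numbers c_1,…,c_d, the vector c_1π_1 + ⋯ + c_dπ_d is a tropical Plücker vector; that is, the conical hull cone(π_1,…,π_d) is contained in the Dressian Dr(k,n). -/
open scoped BigOperators

abbrev KSub (n k : ℕ) : Type := {S : Finset (Fin n) // S.card = k}

/-- `π` is a tropical Plücker vector: for every octahedral index `(L; {a,b,c,d})`, the minimum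
of the three numbers `π_{Lab} + π_{Lcd}`, `π_{Lac} + π_{Lbd}`, `π_{Lad} + π_{Lbc}` is attained
at least twice. -/
def IsTropPlucker {n k : ℕ} (π : KSub n k → ℝ) : Prop :=
  ∀ L : Finset (Fin n), L.card = k - 2 →
  ∀ a b c d : Fin n,
    a ∉ L → b ∉ L → c ∉ L → d ∉ L →
    a < b → b < c → c < d →
  ∀ Sab Sac Sad Sbc Sbd Scd : KSub n k,
    (Sab : Finset (Fin n)) = L ∪ {a, b} →
    (Sac : Finset (Fin n)) = L ∪ {a, c} →
    (Sad : Finset (Fin n)) = L ∪ {a, d} →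
    (Sbc : Finset (Fin n)) = L ∪ {b, c} →
    (Sbd : Finset (Fin n)) = L ∪ {b, d} →
    (Scd : Finset (Fin n)) = L ∪ {c, d} →
    ((π Sab + π Scd = π Sac + π Sbd ∧ π Sab + π Scd ≤ π Sad + π Sbc) ∨
     (π Sab + π Scd = π Sad + π Sbc ∧ π Sab + π Scd ≤ π Sac + π Sbd) ∨
     (π Sac + π Sbd = π Sad + π Sbc ∧ π Sac + π Sbd ≤ π Sab + π Scd))

/-- The minimum of three reals is attained at least twice. -/
def MinTwice (x y z : ℝ) : Prop :=
  (x = y ∧ x ≤ z) ∨ (x = z ∧ x ≤ y) ∨ (y = z ∧ y ≤ x)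

/-- Two points of a tropical line whose sum is on the line lie on a common ray. -/
lemma MinTwice.same_ray {x y z x' y' z' : ℝ} (h' : MinTwice x' y' z')
    (hs : MinTwice (x + x') (y + y') (z + z')) (h : x = y ∧ x < z) : x' = y' ∧ x' ≤ z' := by
  obtain ⟨e, l⟩ := h
  rcases h' with ⟨a, b⟩ | ⟨a, b⟩ | ⟨a, b⟩ <;> rcases hs with ⟨p, q⟩ | ⟨p, q⟩ | ⟨p, q⟩ <;>
    constructor <;> linarith

lemma MinTwice.swap {x y z : ℝ} (h : MinTwice x y z) : MinTwice x z y := by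
  unfold MinTwice at *; grind

lemma MinTwice.rot {x y z : ℝ} (h : MinTwice x y z) : MinTwice y z x := by
  unfold MinTwice at *; grind

lemma common_ray {d : ℕ} (x y z : Fin d → ℝ) (h1 : ∀ i, MinTwice (x i) (y i) (z i))
    (h2 : ∀ i j, MinTwice (x i + x j) (y i + y j) (z i + z j)) :
    (∀ i, x i = y i ∧ x i ≤ z i) ∨ (∀ i, x i = z i ∧ x i ≤ y i) ∨
      (∀ i, y i = z i ∧ y i ≤ x i) := by
  by_cases A : ∃ i, x i = y i ∧ x i < z i
  · obtain ⟨i, hi⟩ := A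
    exact Or.inl fun j => (h1 j).same_ray (h2 i j) hi
  by_cases B : ∃ i, x i = z i ∧ x i < y i
  · obtain ⟨i, hi⟩ := B
    exact Or.inr (Or.inl fun j => (h1 j).swap.same_ray (h2 i j).swap hi)
  by_cases C : ∃ i, y i = z i ∧ y i < x i
  · obtain ⟨i, hi⟩ := C
    exact Or.inr (Or.inr fun j => (h1 j).rot.same_ray (h2 i j).rot hi)
  left
  intro i
  push Not at A B C
  have a := A i
  have b := B i
  have c := C i
  have h := h1 i
  unfold MinTwice at h
  grind

lemma MinTwice.sum {d : ℕ} (x y z : Fin d → ℝ) (h1 : ∀ i, MinTwice (x i) (y i) (z i))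
    (h2 : ∀ i j, MinTwice (x i + x j) (y i + y j) (z i + z j))
    (c : Fin d → ℝ) (hc : ∀ i, 0 ≤ c i) :
    MinTwice (∑ i, c i * x i) (∑ i, c i * y i) (∑ i, c i * z i) := by
  have key : ∀ u v w : Fin d → ℝ, (∀ i, u i = v i ∧ u i ≤ w i) →
      ∑ i, c i * u i = ∑ i, c i * v i ∧ ∑ i, c i * u i ≤ ∑ i, c i * w i := fun u v w h =>
    ⟨Finset.sum_congr rfl fun i _ => by rw [(h i).1],
      Finset.sum_le_sum fun i _ => mul_le_mul_of_nonneg_left (h i).2 (hc i)⟩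
  rcases common_ray x y z h1 h2 with h | h | h
  · exact Or.inl (key _ _ _ h)
  · exact Or.inr (Or.inl (key _ _ _ h))
  · exact Or.inr (Or.inr (key _ _ _ h))

/-- If `π 1, …, π d` are tropical Plücker vectors such that every sum `π i + π j` is again a
tropical Plücker vector, then every nonnegative linear combination `c 1 • π 1 + ⋯ + c d • π d`
is a tropical Plücker vector; that is, `cone (π 1, …, π d) ⊆ Dr(k,n)`. -/
theorem cone_subset_dressian (k n d : ℕ) (hk : 2 ≤ k) (hkn : k + 2 ≤ n)
    (π : Fin d → KSub n k → ℝ)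
    (h1 : ∀ i, IsTropPlucker (π i))
    (h2 : ∀ i j, IsTropPlucker (fun S => π i S + π j S))
    (c : Fin d → ℝ) (hc : ∀ i, 0 ≤ c i) :
    IsTropPlucker (fun S => ∑ i, c i * π i S) := by
  intro L hL a b e f ha hb he hf hab hbe hef Sab Sac Sad Sbc Sbd Scd q1 q2 q3 q4 q5 q6
  have key := MinTwice.sum (fun i => π i Sab + π i Scd) (fun i => π i Sac + π i Sbd)
    (fun i => π i Sad + π i Sbc)
    (fun i => h1 i L hL a b e f ha hb he hf hab hbe hef Sab Sac Sad Sbc Sbd Scd q1 q2 q3 q4 q5 q6)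
    (fun i j => by
      have h := h2 i j L hL a b e f ha hb he hf hab hbe hef
        Sab Sac Sad Sbc Sbd Scd q1 q2 q3 q4 q5 q6
      simp only [add_add_add_comm (π i _) (π j _) (π i _) (π j _)] at h
      exact h) c hc
  simp only [mul_add, Finset.sum_add_distrib] at key
  exact key
end

section
/- For every y = (y₁,y₂,y₃,y₄) ∈ ℝ⁴ with all coordinates positive, all 20 maximal minors p_I(M₄(y)) of the matrix M₄(y) are strictly positive. Consequently, M₄(y) is a realization of the totally positive uniform chirotope of rank 3 on 6 elements (χ(I) = +1 for every 3-subset I of [6]). -/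
open scoped BigOperators

/-- The `3 × 3` minor of a `3 × 6` matrix on columns `i, j, k`, taken in this order. -/
noncomputable def minor3 (A : Matrix (Fin 3) (Fin 6) ℝ) (i j k : Fin 6) : ℝ :=
  Matrix.det (Matrix.of fun r c => A r (![i, j, k] c))

/-- The parameterizing matrix `M₄(y)` of the totally positive chirotope of rank 3 on 6
elements (`y i` stands for `y_{i+1}`). -/
noncomputable def M4 (y : Fin 4 → ℝ) : Matrix (Fin 3) (Fin 6) ℝ :=
  !![1, 0, 0, y 0 * y 2, y 0 * y 2 + y 0 * y 3 + y 1 * y 3,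
       y 0 * y 2 + y 0 * y 3 + y 0 + y 1 + y 1 * y 3 + 1;
     0, 1, 0, -(y 2), -(y 2) - y 3, -(y 2) - y 3 - 1;
     0, 0, 1, 1, 1, 1]

/-- For `y` in the positive orthant, all 20 maximal minors of `M₄(y)` are strictly positive;
consequently `M₄(y)` realizes the totally positive uniform chirotope of rank 3 on 6 elements
(every minor is nonzero with sign `+1`). -/
theorem M4_minors_positive (y : Fin 4 → ℝ) (hy : ∀ i, 0 < y i) :
    (∀ i j k : Fin 6, i < j → j < k → 0 < minor3 (M4 y) i j k) ∧
    (∀ i j k : Fin 6, i < j → j < k →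
      minor3 (M4 y) i j k ≠ 0 ∧ Real.sign (minor3 (M4 y) i j k) = 1) := by
  have key : ∀ i j k : Fin 6, i < j → j < k → 0 < minor3 (M4 y) i j k := by
    have h0 := hy 0
    have h1 := hy 1
    have h2 := hy 2
    have h3 := hy 3
    intro i j k hij hjk
    fin_cases i <;> fin_cases j <;> first
      | (exfalso; revert hij; decide)
      | (fin_cases k <;> first
          | (exfalso; revert hjk; decide)
          | (simp [minor3, M4, Matrix.det_fin_three]; done)
          | (simp only [minor3, M4, Matrix.det_fin_three]
             simp [-sub_pos, -Left.neg_pos_iff, -mul_pos_iff_of_pos_left]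
             first
               | (ring_nf; positivity)
               | (rw [← sub_pos]; ring_nf; positivity)))
  exact ⟨key, fun i j k hij hjk =>
    ⟨(key i j k hij hjk).ne', Real.sign_of_pos (key i j k hij hjk)⟩⟩
end

section
/- For every y = (y₁,y₂,y₃,y₄) ∈ ℝ⁴ with all coordinates positive, writing p_I = p_I(M₄(y)), the following identities hold: (p₁₄₅·p₁₅₆·p₂₃₄)/(p₁₂₅·p₁₃₄·p₄₅₆) = y₁, (p₁₂₄·p₁₅₆·p₃₄₅)/(p₁₂₅·p₁₃₄·p₄₅₆) = y₂, (p₁₂₅·p₁₂₆·p₁₃₄)/(p₁₂₃·p₁₂₄·p₁₅₆) = y₃, and (p₁₂₆·p₁₄₅)/(p₁₂₄·p₁₅₆) = y₄. In particular, the map y ↦ M₄(y) is injective on the positive orthant. -/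
open scoped BigOperators

/-- For `y` in the positive orthant, the cross-ratio identities recovering `y` from the
maximal minors `p_I = p_I (M₄ y)` hold (indices are 0-indexed, so e.g. `p₁₄₅` is
`minor3 (M4 y) 0 3 4`); in particular `y ↦ M₄ y` is injective on the positive orthant. -/
theorem M4_cross_ratios (y : Fin 4 → ℝ) (hy : ∀ i, 0 < y i) :
    (minor3 (M4 y) 0 3 4 * minor3 (M4 y) 0 4 5 * minor3 (M4 y) 1 2 3) /
        (minor3 (M4 y) 0 1 4 * minor3 (M4 y) 0 2 3 * minor3 (M4 y) 3 4 5) = y 0 ∧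
    (minor3 (M4 y) 0 1 3 * minor3 (M4 y) 0 4 5 * minor3 (M4 y) 2 3 4) /
        (minor3 (M4 y) 0 1 4 * minor3 (M4 y) 0 2 3 * minor3 (M4 y) 3 4 5) = y 1 ∧
    (minor3 (M4 y) 0 1 4 * minor3 (M4 y) 0 1 5 * minor3 (M4 y) 0 2 3) /
        (minor3 (M4 y) 0 1 2 * minor3 (M4 y) 0 1 3 * minor3 (M4 y) 0 4 5) = y 2 ∧
    (minor3 (M4 y) 0 1 5 * minor3 (M4 y) 0 3 4) /
        (minor3 (M4 y) 0 1 3 * minor3 (M4 y) 0 4 5) = y 3 ∧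
    (∀ y' : Fin 4 → ℝ, (∀ i, 0 < y' i) → M4 y = M4 y' → y = y') := by
  have m034 : minor3 (M4 y) 0 3 4 = y 3 := by
    simp [minor3, M4, Matrix.det_fin_three] <;> ring
  have m045 : minor3 (M4 y) 0 4 5 = 1 := by
    simp [minor3, M4, Matrix.det_fin_three] <;> ring
  have m123 : minor3 (M4 y) 1 2 3 = y 0 * y 2 := by
    simp [minor3, M4, Matrix.det_fin_three] <;> ring
  have m014 : minor3 (M4 y) 0 1 4 = 1 := by
    simp [minor3, M4, Matrix.det_fin_three] <;> ring
  have m023 : minor3 (M4 y) 0 2 3 = y 2 := by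
    simp [minor3, M4, Matrix.det_fin_three] <;> ring
  have m345 : minor3 (M4 y) 3 4 5 = y 3 := by
    simp [minor3, M4, Matrix.det_fin_three] <;> ring
  have m013 : minor3 (M4 y) 0 1 3 = 1 := by
    simp [minor3, M4, Matrix.det_fin_three] <;> ring
  have m234 : minor3 (M4 y) 2 3 4 = y 1 * y 2 * y 3 := by
    simp [minor3, M4, Matrix.det_fin_three] <;> ring
  have m015 : minor3 (M4 y) 0 1 5 = 1 := by
    simp [minor3, M4, Matrix.det_fin_three] <;> ring
  have m012 : minor3 (M4 y) 0 1 2 = 1 := by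
    simp [minor3, M4, Matrix.det_fin_three] <;> ring
  have h2 := (hy 2).ne'
  have h3 := (hy 3).ne'
  rw [m034, m045, m123, m014, m023, m345, m013, m234, m015, m012]
  refine ⟨by field_simp, by field_simp, by simp, by simp, ?_⟩
  intro y' hy' h
  have e13 : y 2 = y' 2 := by simpa [M4] using congrFun (congrFun h 1) 3
  have e14 : -(y 2) - y 3 = -(y' 2) - y' 3 := by simpa [M4] using congrFun (congrFun h 1) 4
  have e03 : y 0 * y 2 = y' 0 * y' 2 := congrFun (congrFun h 0) 3
  have e04 : y 0 * y 2 + y 0 * y 3 + y 1 * y 3 = y' 0 * y' 2 + y' 0 * y' 3 + y' 1 * y' 3 :=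
    congrFun (congrFun h 0) 4
  have e3 : y 3 = y' 3 := by linarith
  rw [← e13] at e03 e04
  rw [← e3] at e04
  have e0 : y 0 = y' 0 := mul_right_cancel₀ h2 e03
  rw [← e0] at e04
  have e1 : y 1 = y' 1 := mul_right_cancel₀ h3 (by linarith)
  funext i
  fin_cases i
  · exact e0
  · exact e1
  · exact e13
  · exact e3
end

section
/- For every real 3×6 matrix A all of whose 20 maximal 3×3 minors are strictly positive, there exist y ∈ ℝ⁴ with all coordinates positive, an invertible real 3×3 matrix g with det(g) > 0, and positive real numbers t₁,…,t₆ such that A = g · M₄(y) · diag(t₁,…,t₆). In other words, the map y ↦ M₄(y) parameterizes the totally positive chirotopal configuration space X⁺(3,6) = {matrices with all maximal minors positive} modulo the left GL₃(ℝ)-action and right scaling of columns by positive reals. -/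
open scoped BigOperators

/-- Explicit expansion of the minor. -/
lemma minor3_expand (A : Matrix (Fin 3) (Fin 6) ℝ) (i j k : Fin 6) :
    minor3 A i j k = A 0 i * A 1 j * A 2 k - A 0 i * A 1 k * A 2 j
      - A 0 j * A 1 i * A 2 k + A 0 j * A 1 k * A 2 i
      + A 0 k * A 1 i * A 2 j - A 0 k * A 1 j * A 2 i := by
  simp [minor3, Matrix.det_fin_three]

/-- Cramer's rule: each column in terms of the first three. -/
lemma column_coords (A : Matrix (Fin 3) (Fin 6) ℝ) (j : Fin 6) (r : Fin 3)
    (h0 : 0 < minor3 A 0 1 2) (h1 : 0 < minor3 A 0 1 j) :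
    A r j = minor3 A 0 1 j / minor3 A 0 1 2 *
      (A r 0 * (minor3 A 1 2 j / minor3 A 0 1 j)
        - A r 1 * (minor3 A 0 2 j / minor3 A 0 1 j) + A r 2) := by
  have hne := h0.ne'
  have hne1 := h1.ne'
  have key : A r j * minor3 A 0 1 2 = A r 0 * minor3 A 1 2 j - A r 1 * minor3 A 0 2 j
      + A r 2 * minor3 A 0 1 j := by
    simp only [minor3_expand]
    fin_cases r <;> simp <;> ring
  field_simp
  linarith

/-- Solving for the parameters from normalised planar coordinates. -/
lemma solve_params (a4 a5 a6 b4 b5 b6 : ℝ) (ha4 : 0 < a4) (hb4 : 0 < b4)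
    (h45 : 0 < b5 - b4) (h56 : 0 < b6 - b5) (h345 : 0 < a5 * b4 - a4 * b5)
    (h456 : 0 < (a6 - a5) * (b5 - b4) - (a5 - a4) * (b6 - b5)) :
    ∃ y0 y1 y2 y3 u v : ℝ, 0 < y0 ∧ 0 < y1 ∧ 0 < y2 ∧ 0 < y3 ∧ 0 < u ∧ 0 < v ∧
      a4 = u * (y0 * y2) ∧ a5 = u * (y0 * y2 + y0 * y3 + y1 * y3) ∧
      a6 = u * (y0 * y2 + y0 * y3 + y0 + y1 + y1 * y3 + 1) ∧
      b4 = v * y2 ∧ b5 = v * (y2 + y3) ∧ b6 = v * (y2 + y3 + 1) := by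
  obtain ⟨v, hv⟩ : ∃ v, v = b6 - b5 := ⟨_, rfl⟩
  obtain ⟨w, hw⟩ : ∃ w, w = b5 - b4 := ⟨_, rfl⟩
  obtain ⟨s0, hs0⟩ : ∃ s, s = a4 / b4 := ⟨_, rfl⟩
  obtain ⟨s1, hs1⟩ : ∃ s, s = (a5 - a4) / w := ⟨_, rfl⟩
  obtain ⟨s2, hs2⟩ : ∃ s, s = (a6 - a5) / v := ⟨_, rfl⟩
  rw [← hv] at h56 h456
  rw [← hw] at h45 h456
  have e0 : a4 = s0 * b4 := by rw [hs0]; field_simp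
  have e1 : a5 = s0 * b4 + s1 * w := by rw [← e0, hs1]; field_simp; ring
  have e2 : a6 = s0 * b4 + s1 * w + s2 * v := by rw [← e1, hs2]; field_simp; ring
  have p0 : 0 < s0 := by rw [hs0]; positivity
  have p1 : 0 < s1 - s0 := by
    rw [hs0, hs1, sub_pos, div_lt_div_iff₀ hb4 h45, hw]; linarith
  have p2 : 0 < s2 - s1 := by
    rw [hs2, hs1, sub_pos, div_lt_div_iff₀ h45 h56]; linarith
  have hb5 : b5 = b4 + w := by linarith
  have hb6 : b6 = b4 + w + v := by linarith
  refine ⟨s0 / (s2 - s1), (s1 - s0) / (s2 - s1), b4 / v, w / v, v * (s2 - s1), v,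
    by positivity, by positivity, by positivity, by positivity, by positivity, h56,
    ?_, ?_, ?_, ?_, ?_, ?_⟩
  · rw [e0]; field_simp
  · rw [e1]; field_simp; ring
  · rw [e2]; field_simp; ring
  · field_simp
  · rw [hb5]; field_simp
  · rw [hb6]; field_simp

/-- Every real `3 × 6` matrix with all 20 maximal minors strictly positive is of the form
`g * M₄ y * diag (t₁, …, t₆)` for some `y` in the positive orthant, some invertible `3 × 3`
matrix `g` with positive determinant, and positive column scalings `t`: the map `y ↦ M₄ y`
parameterizes the totally positive configuration space `X⁺(3,6)`. -/
theorem M4_parameterizes_totally_positive (A : Matrix (Fin 3) (Fin 6) ℝ)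
    (hA : ∀ i j k : Fin 6, i < j → j < k → 0 < minor3 A i j k) :
    ∃ (y : Fin 4 → ℝ) (g : Matrix (Fin 3) (Fin 3) ℝ) (t : Fin 6 → ℝ),
      (∀ i, 0 < y i) ∧ IsUnit g ∧ 0 < g.det ∧ (∀ j, 0 < t j) ∧
      A = g * M4 y * Matrix.diagonal t := by
  have H012 := hA 0 1 2 (by decide) (by decide)
  have H013 := hA 0 1 3 (by decide) (by decide)
  have H014 := hA 0 1 4 (by decide) (by decide)
  have H015 := hA 0 1 5 (by decide) (by decide)
  have H023 := hA 0 2 3 (by decide) (by decide)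
  have H123 := hA 1 2 3 (by decide) (by decide)
  have H034 := hA 0 3 4 (by decide) (by decide)
  have H045 := hA 0 4 5 (by decide) (by decide)
  have H234 := hA 2 3 4 (by decide) (by decide)
  have H345 := hA 3 4 5 (by decide) (by decide)
  have c3 := fun r => column_coords A 3 r H012 H013
  have c4 := fun r => column_coords A 4 r H012 H014
  have c5 := fun r => column_coords A 5 r H012 H015
  have pa4 := div_pos H123 H013
  have pb4 := div_pos H023 H013
  have pd4 := div_pos H013 H012
  have pd5 := div_pos H014 H012
  have pd6 := div_pos H015 H012
  generalize minor3 A 1 2 3 / minor3 A 0 1 3 = a4 at *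
  generalize minor3 A 0 2 3 / minor3 A 0 1 3 = b4 at *
  generalize minor3 A 0 1 3 / minor3 A 0 1 2 = d4 at *
  generalize minor3 A 1 2 4 / minor3 A 0 1 4 = a5 at *
  generalize minor3 A 0 2 4 / minor3 A 0 1 4 = b5 at *
  generalize minor3 A 0 1 4 / minor3 A 0 1 2 = d5 at *
  generalize minor3 A 1 2 5 / minor3 A 0 1 5 = a6 at *
  generalize minor3 A 0 2 5 / minor3 A 0 1 5 = b6 at *
  generalize minor3 A 0 1 5 / minor3 A 0 1 2 = d6 at *
  have q1 : minor3 A 0 3 4 = (minor3 A 0 1 2 * d4 * d5) * (b5 - b4) := by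
    simp only [minor3_expand, c3, c4]; ring
  have q2 : minor3 A 0 4 5 = (minor3 A 0 1 2 * d5 * d6) * (b6 - b5) := by
    simp only [minor3_expand, c4, c5]; ring
  have q3 : minor3 A 2 3 4 = (minor3 A 0 1 2 * d4 * d5) * (a5 * b4 - a4 * b5) := by
    simp only [minor3_expand, c3, c4]; ring
  have q4 : minor3 A 3 4 5 = (minor3 A 0 1 2 * d4 * d5 * d6) *
      ((a6 - a5) * (b5 - b4) - (a5 - a4) * (b6 - b5)) := by
    simp only [minor3_expand, c3, c4, c5]; ring
  rw [q1] at H034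
  rw [q2] at H045
  rw [q3] at H234
  rw [q4] at H345
  obtain ⟨y0, y1, y2, y3, u, v, hy0, hy1, hy2, hy3, hu, hv, e1, e2, e3, e4, e5, e6⟩ :=
    solve_params a4 a5 a6 b4 b5 b6 pa4 pb4
      (pos_of_mul_pos_right H034 (by positivity)) (pos_of_mul_pos_right H045 (by positivity))
      (pos_of_mul_pos_right H234 (by positivity)) (pos_of_mul_pos_right H345 (by positivity))
  have hdet : 0 < (!![A 0 0 * u, A 0 1 * v, A 0 2; A 1 0 * u, A 1 1 * v, A 1 2;
      A 2 0 * u, A 2 1 * v, A 2 2] : Matrix (Fin 3) (Fin 3) ℝ).det := by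
    have : (!![A 0 0 * u, A 0 1 * v, A 0 2; A 1 0 * u, A 1 1 * v, A 1 2;
      A 2 0 * u, A 2 1 * v, A 2 2] : Matrix (Fin 3) (Fin 3) ℝ).det
        = u * v * minor3 A 0 1 2 := by
      rw [minor3_expand, Matrix.det_fin_three]; simp; ring
    rw [this]; positivity
  refine ⟨![y0, y1, y2, y3], !![A 0 0 * u, A 0 1 * v, A 0 2; A 1 0 * u, A 1 1 * v, A 1 2;
      A 2 0 * u, A 2 1 * v, A 2 2], ![1 / u, 1 / v, 1, d4, d5, d6], ?_, ?_, hdet, ?_, ?_⟩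
  · intro i; fin_cases i <;> simpa
  · rw [Matrix.isUnit_iff_isUnit_det]; exact hdet.ne'.isUnit
  · intro j; fin_cases j <;> simp <;> assumption
  · have hu' := hu.ne'
    have hv' := hv.ne'
    rw [e1, e4] at c3
    rw [e2, e5] at c4
    rw [e3, e6] at c5
    ext r j
    rw [Matrix.mul_diagonal, Matrix.mul_apply, Fin.sum_univ_three]
    fin_cases j
    · fin_cases r <;> simp [M4] <;> field_simp
    · fin_cases r <;> simp [M4] <;> field_simp
    · fin_cases r <;> simp [M4]
    · refine (c3 r).trans ?_
      fin_cases r <;> simp [M4] <;> ring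
    · refine (c4 r).trans ?_
      fin_cases r <;> simp [M4] <;> ring
    · refine (c5 r).trans ?_
      fin_cases r <;> simp [M4] <;> ring
end

section
/- For every y = (y₁,y₂,y₃,y₄) ∈ ℝ⁴ with all coordinates positive, writing p_I = p_I(M₃(y)), the following identities hold: (p₁₂₅·p₂₃₄)/(p₁₂₃·p₂₄₅) = y₁, (p₁₅₆·p₂₃₅)/(p₁₂₅·p₃₅₆) = y₂, (p₁₂₆·p₂₄₅)/(p₁₂₄·p₂₅₆) = y₃, and −(p₁₄₅·p₃₅₆)/(p₁₃₅·p₄₅₆) = y₄. In particular, the map y ↦ M₃(y) is injective on the positive orthant. -/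
open scoped BigOperators

/-- The parameterizing matrix `M₃(y)` of the type-3 chirotope of rank 3 on 6 elements
(`y i` stands for `y_{i+1}`). -/
noncomputable def M3 (y : Fin 4 → ℝ) : Matrix (Fin 3) (Fin 6) ℝ :=
  !![1, 0, 0, 1, (y 0 + 1) / y 0, (y 0 * y 2 + y 2 + 1) / (y 0 * y 2);
     0, 1, 0, -1,
       -((y 0 + 1) * (y 1 * y 3 + y 3 + 1)) /
         (y 0 * y 1 * y 3 + y 0 * y 3 + y 0 + y 3 + 1),
       -((y 0 * y 1 * y 2 + y 1 * y 2 + y 1 + y 0 * y 2 + y 2) * (y 1 * y 3 + y 3 + 1)) /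
         ((y 1 + 1) * y 2 * (y 0 * y 1 * y 3 + y 0 * y 3 + y 0 + y 3 + 1));
     0, 0, 1, 1, 1, 1]

lemma M3_minor_125 (y : Fin 4 → ℝ) (hy : ∀ i, 0 < y i) :
    minor3 (M3 y) 0 1 4 = 1 := by
  have ha := hy 0
  have hb := hy 1
  have hc := hy 2
  have hd := hy 3
  have hD : (y 0 * y 1 * y 3 + y 0 * y 3 + y 0 + y 3 + 1) ≠ 0 := by positivity
  have hB : y 1 + 1 ≠ 0 := by positivity
  simp [minor3, M3, Matrix.det_fin_three]
  try field_simp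
  try ring

lemma M3_minor_234 (y : Fin 4 → ℝ) (hy : ∀ i, 0 < y i) :
    minor3 (M3 y) 1 2 3 = 1 := by
  have ha := hy 0
  have hb := hy 1
  have hc := hy 2
  have hd := hy 3
  have hD : (y 0 * y 1 * y 3 + y 0 * y 3 + y 0 + y 3 + 1) ≠ 0 := by positivity
  have hB : y 1 + 1 ≠ 0 := by positivity
  simp [minor3, M3, Matrix.det_fin_three]
  try field_simp
  try ring

lemma M3_minor_123 (y : Fin 4 → ℝ) (hy : ∀ i, 0 < y i) :
    minor3 (M3 y) 0 1 2 = 1 := by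
  have ha := hy 0
  have hb := hy 1
  have hc := hy 2
  have hd := hy 3
  have hD : (y 0 * y 1 * y 3 + y 0 * y 3 + y 0 + y 3 + 1) ≠ 0 := by positivity
  have hB : y 1 + 1 ≠ 0 := by positivity
  simp [minor3, M3, Matrix.det_fin_three]
  try field_simp
  try ring

lemma M3_minor_126 (y : Fin 4 → ℝ) (hy : ∀ i, 0 < y i) :
    minor3 (M3 y) 0 1 5 = 1 := by
  have ha := hy 0
  have hb := hy 1
  have hc := hy 2
  have hd := hy 3
  have hD : (y 0 * y 1 * y 3 + y 0 * y 3 + y 0 + y 3 + 1) ≠ 0 := by positivity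
  have hB : y 1 + 1 ≠ 0 := by positivity
  simp [minor3, M3, Matrix.det_fin_three]
  try field_simp
  try ring

lemma M3_minor_124 (y : Fin 4 → ℝ) (hy : ∀ i, 0 < y i) :
    minor3 (M3 y) 0 1 3 = 1 := by
  have ha := hy 0
  have hb := hy 1
  have hc := hy 2
  have hd := hy 3
  have hD : (y 0 * y 1 * y 3 + y 0 * y 3 + y 0 + y 3 + 1) ≠ 0 := by positivity
  have hB : y 1 + 1 ≠ 0 := by positivity
  simp [minor3, M3, Matrix.det_fin_three]
  try field_simp
  try ring

lemma M3_minor_245 (y : Fin 4 → ℝ) (hy : ∀ i, 0 < y i) :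
    minor3 (M3 y) 1 3 4 = 1 / y 0 := by
  have ha := hy 0
  have hb := hy 1
  have hc := hy 2
  have hd := hy 3
  have hD : (y 0 * y 1 * y 3 + y 0 * y 3 + y 0 + y 3 + 1) ≠ 0 := by positivity
  have hB : y 1 + 1 ≠ 0 := by positivity
  simp [minor3, M3, Matrix.det_fin_three]
  try field_simp
  try ring

lemma M3_minor_156 (y : Fin 4 → ℝ) (hy : ∀ i, 0 < y i) :
    minor3 (M3 y) 0 4 5 = y 1 * (y 1 * y 3 + y 3 + 1) / ((y 1 + 1) * y 2 * (y 0 * y 1 * y 3 + y 0 * y 3 + y 0 + y 3 + 1)) := by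
  have ha := hy 0
  have hb := hy 1
  have hc := hy 2
  have hd := hy 3
  have hD : (y 0 * y 1 * y 3 + y 0 * y 3 + y 0 + y 3 + 1) ≠ 0 := by positivity
  have hB : y 1 + 1 ≠ 0 := by positivity
  simp [minor3, M3, Matrix.det_fin_three]
  try field_simp
  try ring

lemma M3_minor_235 (y : Fin 4 → ℝ) (hy : ∀ i, 0 < y i) :
    minor3 (M3 y) 1 2 4 = (y 0 + 1) / y 0 := by
  have ha := hy 0
  have hb := hy 1
  have hc := hy 2
  have hd := hy 3
  have hD : (y 0 * y 1 * y 3 + y 0 * y 3 + y 0 + y 3 + 1) ≠ 0 := by positivity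
  have hB : y 1 + 1 ≠ 0 := by positivity
  simp [minor3, M3, Matrix.det_fin_three]
  try field_simp
  try ring

lemma M3_minor_356 (y : Fin 4 → ℝ) (hy : ∀ i, 0 < y i) :
    minor3 (M3 y) 2 4 5 = (y 0 + 1) * (y 1 * y 3 + y 3 + 1) / (y 0 * y 2 * (y 1 + 1) * (y 0 * y 1 * y 3 + y 0 * y 3 + y 0 + y 3 + 1)) := by
  have ha := hy 0
  have hb := hy 1
  have hc := hy 2
  have hd := hy 3
  have hD : (y 0 * y 1 * y 3 + y 0 * y 3 + y 0 + y 3 + 1) ≠ 0 := by positivity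
  have hB : y 1 + 1 ≠ 0 := by positivity
  simp [minor3, M3, Matrix.det_fin_three]
  try field_simp
  try ring

lemma M3_minor_256 (y : Fin 4 → ℝ) (hy : ∀ i, 0 < y i) :
    minor3 (M3 y) 1 4 5 = 1 / (y 0 * y 2) := by
  have ha := hy 0
  have hb := hy 1
  have hc := hy 2
  have hd := hy 3
  have hD : (y 0 * y 1 * y 3 + y 0 * y 3 + y 0 + y 3 + 1) ≠ 0 := by positivity
  have hB : y 1 + 1 ≠ 0 := by positivity
  simp [minor3, M3, Matrix.det_fin_three]
  try field_simp
  try ring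

lemma M3_minor_145 (y : Fin 4 → ℝ) (hy : ∀ i, 0 < y i) :
    minor3 (M3 y) 0 3 4 = y 1 * y 3 / (y 0 * y 1 * y 3 + y 0 * y 3 + y 0 + y 3 + 1) := by
  have ha := hy 0
  have hb := hy 1
  have hc := hy 2
  have hd := hy 3
  have hD : (y 0 * y 1 * y 3 + y 0 * y 3 + y 0 + y 3 + 1) ≠ 0 := by positivity
  have hB : y 1 + 1 ≠ 0 := by positivity
  simp [minor3, M3, Matrix.det_fin_three]
  try field_simp
  try ring

lemma M3_minor_135 (y : Fin 4 → ℝ) (hy : ∀ i, 0 < y i) :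
    minor3 (M3 y) 0 2 4 = (y 0 + 1) * (y 1 * y 3 + y 3 + 1) / (y 0 * y 1 * y 3 + y 0 * y 3 + y 0 + y 3 + 1) := by
  have ha := hy 0
  have hb := hy 1
  have hc := hy 2
  have hd := hy 3
  have hD : (y 0 * y 1 * y 3 + y 0 * y 3 + y 0 + y 3 + 1) ≠ 0 := by positivity
  have hB : y 1 + 1 ≠ 0 := by positivity
  simp [minor3, M3, Matrix.det_fin_three]
  try field_simp
  try ring

lemma M3_minor_456 (y : Fin 4 → ℝ) (hy : ∀ i, 0 < y i) :
    minor3 (M3 y) 3 4 5 = -(y 1 / (y 0 * y 2 * (y 1 + 1) * (y 0 * y 1 * y 3 + y 0 * y 3 + y 0 + y 3 + 1))) := by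
  have ha := hy 0
  have hb := hy 1
  have hc := hy 2
  have hd := hy 3
  have hD : (y 0 * y 1 * y 3 + y 0 * y 3 + y 0 + y 3 + 1) ≠ 0 := by positivity
  have hB : y 1 + 1 ≠ 0 := by positivity
  simp [minor3, M3, Matrix.det_fin_three]
  try field_simp
  try ring

lemma M3_ratios (y : Fin 4 → ℝ) (hy : ∀ i, 0 < y i) :
    (minor3 (M3 y) 0 1 4 * minor3 (M3 y) 1 2 3) /
        (minor3 (M3 y) 0 1 2 * minor3 (M3 y) 1 3 4) = y 0 ∧
    (minor3 (M3 y) 0 4 5 * minor3 (M3 y) 1 2 4) /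
        (minor3 (M3 y) 0 1 4 * minor3 (M3 y) 2 4 5) = y 1 ∧
    (minor3 (M3 y) 0 1 5 * minor3 (M3 y) 1 3 4) /
        (minor3 (M3 y) 0 1 3 * minor3 (M3 y) 1 4 5) = y 2 ∧
    -((minor3 (M3 y) 0 3 4 * minor3 (M3 y) 2 4 5) /
        (minor3 (M3 y) 0 2 4 * minor3 (M3 y) 3 4 5)) = y 3 := by
  have ha := hy 0
  have hb := hy 1
  have hc := hy 2
  have hd := hy 3
  have hD : (y 0 * y 1 * y 3 + y 0 * y 3 + y 0 + y 3 + 1) ≠ 0 := by positivity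
  have hN : (y 1 * y 3 + y 3 + 1) ≠ 0 := by positivity
  have hB : y 1 + 1 ≠ 0 := by positivity
  have hA : y 0 + 1 ≠ 0 := by positivity
  rw [M3_minor_125 y hy, M3_minor_234 y hy, M3_minor_123 y hy, M3_minor_126 y hy, M3_minor_124 y hy, M3_minor_245 y hy, M3_minor_156 y hy, M3_minor_235 y hy, M3_minor_356 y hy, M3_minor_256 y hy, M3_minor_145 y hy, M3_minor_135 y hy, M3_minor_456 y hy]
  refine ⟨?_, ?_, ?_, ?_⟩ <;> field_simp

/-- For `y` in the positive orthant, the cross-ratio identities recovering `y` from the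
maximal minors `p_I = p_I (M₃ y)` hold (indices are 0-indexed, so e.g. `p₁₂₅` is
`minor3 (M3 y) 0 1 4`); in particular `y ↦ M₃ y` is injective on the positive orthant. -/
theorem M3_cross_ratios (y : Fin 4 → ℝ) (hy : ∀ i, 0 < y i) :
    (minor3 (M3 y) 0 1 4 * minor3 (M3 y) 1 2 3) /
        (minor3 (M3 y) 0 1 2 * minor3 (M3 y) 1 3 4) = y 0 ∧
    (minor3 (M3 y) 0 4 5 * minor3 (M3 y) 1 2 4) /
        (minor3 (M3 y) 0 1 4 * minor3 (M3 y) 2 4 5) = y 1 ∧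
    (minor3 (M3 y) 0 1 5 * minor3 (M3 y) 1 3 4) /
        (minor3 (M3 y) 0 1 3 * minor3 (M3 y) 1 4 5) = y 2 ∧
    -((minor3 (M3 y) 0 3 4 * minor3 (M3 y) 2 4 5) /
        (minor3 (M3 y) 0 2 4 * minor3 (M3 y) 3 4 5)) = y 3 ∧
    (∀ y' : Fin 4 → ℝ, (∀ i, 0 < y' i) → M3 y = M3 y' → y = y') := by
  obtain ⟨h0, h1, h2, h3⟩ := M3_ratios y hy
  refine ⟨h0, h1, h2, h3, ?_⟩
  intro z hz h
  obtain ⟨g0, g1, g2, g3⟩ := M3_ratios z hz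
  rw [h] at h0 h1 h2 h3
  funext i
  fin_cases i
  · exact h0.symm.trans g0
  · exact h1.symm.trans g1
  · exact h2.symm.trans g2
  · exact h3.symm.trans g3
end

section
/- For every y = (y₁,y₂,y₃,y₄) ∈ ℝ⁴ with all coordinates positive, all denominators occurring in the entries of M₂(y) are nonzero, all 20 maximal minors p_I(M₂(y)) are nonzero, and their signs realize the chirotope χ of rank 3 on 6 elements with χ(I) = −1 exactly for I ∈ {{1,3,4},{1,3,5},{1,3,6},{2,3,5},{2,3,6},{2,4,5},{2,4,6},{2,5,6}} and χ(I) = +1 for every other 3-subset I of [6]; that is, p_I(M₂(y)) < 0 for I in this list and p_I(M₂(y)) > 0 otherwise. -/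
open scoped BigOperators

/-- The parameterizing matrix `M₂(y)` of the type-2 chirotope of rank 3 on 6 elements
(`y i` stands for `y_{i+1}`). -/
noncomputable def M2 (y : Fin 4 → ℝ) : Matrix (Fin 3) (Fin 6) ℝ :=
  !![1, 0, 0, 1, -1 / y 0,
       -(y 0 * y 1 * y 2 + y 1 * y 2 + y 0 * y 1 * y 2 * y 3 + y 1 * y 2 * y 3 + y 2 * y 3 +
           y 2 + y 0 * y 1 * y 3 + y 1 * y 3 + y 3 + 1) /
         (y 0 * (y 2 + 1) * (y 0 * y 1 * y 3 + y 1 * y 3 + y 3 + 1));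
     0, 1, 0, 1, y 1 / (y 1 + 1), y 1 / ((y 1 + 1) * (y 2 + 1));
     0, 0, 1, 1, 1, 1]

/-- The list of 3-subsets of `Fin 6` on which the type-2 chirotope is negative (0-indexed:
`{1,3,4}, {1,3,5}, {1,3,6}, {2,3,5}, {2,3,6}, {2,4,5}, {2,4,6}, {2,5,6}`). -/
def negSets2 : Finset (Finset (Fin 6)) :=
  {{0, 2, 3}, {0, 2, 4}, {0, 2, 5}, {1, 2, 4}, {1, 2, 5}, {1, 3, 4}, {1, 3, 5}, {1, 4, 5}}

/-- For `y` in the positive orthant, all denominators occurring in the entries of `M₂(y)` are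
nonzero, and the 20 maximal minors of `M₂(y)` are nonzero with sign pattern realizing the
type-2 chirotope: negative exactly on `negSets2` and positive otherwise. -/
theorem M2_minor_signs (y : Fin 4 → ℝ) (hy : ∀ i, 0 < y i) :
    (y 0 ≠ 0 ∧ y 0 * (y 2 + 1) * (y 0 * y 1 * y 3 + y 1 * y 3 + y 3 + 1) ≠ 0 ∧
      y 1 + 1 ≠ 0 ∧ (y 1 + 1) * (y 2 + 1) ≠ 0) ∧
    (∀ i j k : Fin 6, i < j → j < k →
      if ({i, j, k} : Finset (Fin 6)) ∈ negSets2 then minor3 (M2 y) i j k < 0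
      else 0 < minor3 (M2 y) i j k) := by
  have ha := hy 0
  have hb := hy 1
  have hc := hy 2
  have hd := hy 3
  refine ⟨⟨by positivity, by positivity, by positivity, by positivity⟩, ?_⟩
  obtain ⟨u, hu⟩ : ∃ u, u = 1 / y 0 := ⟨_, rfl⟩
  obtain ⟨v, hv⟩ : ∃ v, v = (y 0 * y 1 * y 2 + y 1 * y 2 + y 0 * y 1 * y 2 * y 3 +
      y 1 * y 2 * y 3 + y 2 * y 3 + y 2 + y 0 * y 1 * y 3 + y 1 * y 3 + y 3 + 1) /
         (y 0 * (y 2 + 1) * (y 0 * y 1 * y 3 + y 1 * y 3 + y 3 + 1)) := ⟨_, rfl⟩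
  obtain ⟨s, hs⟩ : ∃ s, s = y 1 / (y 1 + 1) := ⟨_, rfl⟩
  obtain ⟨t, ht⟩ : ∃ t, t = y 1 / ((y 1 + 1) * (y 2 + 1)) := ⟨_, rfl⟩
  have hM : M2 y = !![1, 0, 0, 1, -u, -v; 0, 1, 0, 1, s, t; 0, 0, 1, 1, 1, 1] := by
    rw [hu, hv, hs, ht, ← neg_div, ← neg_div]
    rfl
  have hu0 : 0 < u := by rw [hu]; positivity
  have ht0 : 0 < t := by rw [ht]; positivity
  have hs1 : 0 < 1 - s := by
    have : 1 - s = 1 / (y 1 + 1) := by rw [hs]; field_simp; ring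
    rw [this]; positivity
  have hst : 0 < s - t := by
    have : s - t = y 1 * y 2 / ((y 1 + 1) * (y 2 + 1)) := by rw [hs, ht]; field_simp; ring
    rw [this]; positivity
  have huv : 0 < v - u := by
    have : v - u = (y 0 + 1) * y 1 * y 2 /
        (y 0 * (y 2 + 1) * (y 0 * y 1 * y 3 + y 1 * y 3 + y 3 + 1)) := by
      rw [hu, hv]; field_simp; ring
    rw [this]; positivity
  have hsv : 0 < s * v - u * t := by
    have hs0 : 0 < s := by linarith
    nlinarith [mul_pos hst hu0, mul_pos hs0 huv]
  have h456 : 0 < s - t - (v - u) + (s * v - u * t) := by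
    have : s - t - (v - u) + (s * v - u * t) =
        (y 0 + 1) * y 1 * y 2 * (y 0 * y 1 * y 3 + y 1 * y 3 + y 3) /
        (y 0 * (y 1 + 1) * (y 2 + 1) * (y 0 * y 1 * y 3 + y 1 * y 3 + y 3 + 1)) := by
      rw [hu, hv, hs, ht]; field_simp; ring
    rw [this]; positivity
  rw [hM]
  clear hM hu hv hs ht
  intro i j k hij hjk
  fin_cases i <;> fin_cases j <;> first
    | exact absurd hij (by decide)
    | (fin_cases k <;> first
        | exact absurd hjk (by decide)
        | (rw [if_pos (by decide)]
           simp [minor3, Matrix.det_fin_three]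
           try linarith)
        | (rw [if_neg (by decide)]
           simp [minor3, Matrix.det_fin_three]
           try linarith))
end

section
/- For every y = (y₁,y₂,y₃,y₄) ∈ ℝ⁴ with all coordinates positive, writing p_I = p_I(M₂(y)), the following identities hold: −(p₁₂₅·p₂₃₄)/(p₁₂₄·p₂₃₅) = y₁, −(p₁₂₄·p₁₃₅)/(p₁₂₃·p₁₄₅) = y₂, −(p₁₂₃·p₁₅₆)/(p₁₂₅·p₁₃₆) = y₃, and (p₂₃₅·p₄₅₆)/(p₂₅₆·p₃₄₅) = y₄. In particular, the map y ↦ M₂(y) is injective on the positive orthant. -/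
open scoped BigOperators

theorem cross_aux (y : Fin 4 → ℝ) (hy : ∀ i, 0 < y i) :
    -((minor3 (M2 y) 0 1 4 * minor3 (M2 y) 1 2 3) /
        (minor3 (M2 y) 0 1 3 * minor3 (M2 y) 1 2 4)) = y 0 ∧
    -((minor3 (M2 y) 0 1 3 * minor3 (M2 y) 0 2 4) /
        (minor3 (M2 y) 0 1 2 * minor3 (M2 y) 0 3 4)) = y 1 ∧
    -((minor3 (M2 y) 0 1 2 * minor3 (M2 y) 0 4 5) /
        (minor3 (M2 y) 0 1 4 * minor3 (M2 y) 0 2 5)) = y 2 ∧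
    (minor3 (M2 y) 1 2 4 * minor3 (M2 y) 3 4 5) /
        (minor3 (M2 y) 1 4 5 * minor3 (M2 y) 2 3 4) = y 3 := by
  have h0 := hy 0
  have h1 := hy 1
  have h2 := hy 2
  have h3 := hy 3
  have m014 : minor3 (M2 y) 0 1 4 = 1 := by
    simp [minor3, M2, Matrix.det_fin_three]
  have m123 : minor3 (M2 y) 1 2 3 = 1 := by
    simp [minor3, M2, Matrix.det_fin_three]
  have m013 : minor3 (M2 y) 0 1 3 = 1 := by
    simp [minor3, M2, Matrix.det_fin_three]
  have m012 : minor3 (M2 y) 0 1 2 = 1 := by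
    simp [minor3, M2, Matrix.det_fin_three]
  have m124 : minor3 (M2 y) 1 2 4 = -1 / y 0 := by
    simp [minor3, M2, Matrix.det_fin_three]
  have m024 : minor3 (M2 y) 0 2 4 = -(y 1 / (y 1 + 1)) := by
    simp [minor3, M2, Matrix.det_fin_three]
  have m025 : minor3 (M2 y) 0 2 5 = -(y 1 / ((y 1 + 1) * (y 2 + 1))) := by
    simp [minor3, M2, Matrix.det_fin_three]
  have m034 : minor3 (M2 y) 0 3 4 = 1 / (y 1 + 1) := by
    simp [minor3, M2, Matrix.det_fin_three]
    field_simp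
    ring
  have m045 : minor3 (M2 y) 0 4 5 = y 1 * y 2 / ((y 1 + 1) * (y 2 + 1)) := by
    simp [minor3, M2, Matrix.det_fin_three]
    field_simp
    ring
  have hQ : 0 < y 0 * y 1 * y 3 + y 1 * y 3 + y 3 + 1 := by positivity
  have hR : 0 < y 0 * y 1 + y 1 + 1 := by positivity
  have m145 : minor3 (M2 y) 1 4 5 = -(y 2 * y 1 * (y 0 + 1)) /
      (y 0 * (y 2 + 1) * (y 0 * y 1 * y 3 + y 1 * y 3 + y 3 + 1)) := by
    simp [minor3, M2, Matrix.det_fin_three]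
    field_simp
    ring
  have m234 : minor3 (M2 y) 2 3 4 = (y 0 * y 1 + y 1 + 1) / (y 0 * (y 1 + 1)) := by
    simp [minor3, M2, Matrix.det_fin_three]
    field_simp
    ring
  have m345 : minor3 (M2 y) 3 4 5 =
      y 1 * y 2 * (y 0 + 1) * y 3 * (y 0 * y 1 + y 1 + 1) /
      (y 0 * (y 1 + 1) * (y 2 + 1) * (y 0 * y 1 * y 3 + y 1 * y 3 + y 3 + 1)) := by
    simp [minor3, M2, Matrix.det_fin_three]
    field_simp
    ring
  rw [m014, m123, m013, m012, m124, m024, m025, m034, m045, m145, m234, m345]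
  refine ⟨?_, ?_, ?_, ?_⟩ <;> field_simp

/-- For `y` in the positive orthant, the cross-ratio identities recovering `y` from the
maximal minors `p_I = p_I (M₂ y)` hold (indices are 0-indexed, so e.g. `p₁₂₅` is
`minor3 (M2 y) 0 1 4`); in particular `y ↦ M₂ y` is injective on the positive orthant. -/
theorem M2_cross_ratios (y : Fin 4 → ℝ) (hy : ∀ i, 0 < y i) :
    -((minor3 (M2 y) 0 1 4 * minor3 (M2 y) 1 2 3) /
        (minor3 (M2 y) 0 1 3 * minor3 (M2 y) 1 2 4)) = y 0 ∧
    -((minor3 (M2 y) 0 1 3 * minor3 (M2 y) 0 2 4) /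
        (minor3 (M2 y) 0 1 2 * minor3 (M2 y) 0 3 4)) = y 1 ∧
    -((minor3 (M2 y) 0 1 2 * minor3 (M2 y) 0 4 5) /
        (minor3 (M2 y) 0 1 4 * minor3 (M2 y) 0 2 5)) = y 2 ∧
    (minor3 (M2 y) 1 2 4 * minor3 (M2 y) 3 4 5) /
        (minor3 (M2 y) 1 4 5 * minor3 (M2 y) 2 3 4) = y 3 ∧
    (∀ y' : Fin 4 → ℝ, (∀ i, 0 < y' i) → M2 y = M2 y' → y = y') := by
  obtain ⟨e0, e1, e2, e3⟩ := cross_aux y hy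
  refine ⟨e0, e1, e2, e3, ?_⟩
  intro y' hy' h
  obtain ⟨f0, f1, f2, f3⟩ := cross_aux y' hy'
  rw [h] at e0 e1 e2 e3
  funext i
  fin_cases i
  · exact e0.symm.trans f0
  · exact e1.symm.trans f1
  · exact e2.symm.trans f2
  · exact e3.symm.trans f3
end

section
/- For every y = (y₁,y₂,y₃,y₄) ∈ ℝ⁴ with all coordinates positive, all denominators occurring in the entries of M₁(y) are nonzero, all 20 maximal minors p_I(M₁(y)) are nonzero, and their signs realize the chirotope χ of rank 3 on 6 elements with χ(I) = −1 exactly for I ∈ {{1,3,4},{1,3,5},{1,4,5},{2,3,5},{2,4,5},{3,4,6},{3,5,6}} and χ(I) = +1 for every other 3-subset I of [6]; that is, p_I(M₁(y)) < 0 for I in this list and p_I(M₁(y)) > 0 otherwise. -/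
open scoped BigOperators

/-- The parameterizing matrix `M₁(y)` of the type-1 chirotope of rank 3 on 6 elements
(`y i` stands for `y_{i+1}`). -/
noncomputable def M1 (y : Fin 4 → ℝ) : Matrix (Fin 3) (Fin 6) ℝ :=
  !![1, 0, 0, 1, -1 / y 2, (y 1 * y 2 + y 2 + 1) / (y 1 * y 2);
     0, 1, 0, 1,
       ((y 0 * y 1 + y 1 + 1) * (y 3 + 1)) / (y 0 * y 1 * y 3 + y 1 * y 3 + y 3 + 1),
       -(y 0 * (y 1 * y 2 + y 2 + 1) * (y 3 + 1)) /
         (y 1 * y 2 + y 1 * y 2 * y 3 + y 2 * y 3 + y 2 + y 0 * y 1 * y 3 + y 1 * y 3 +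
           y 3 + 1);
     0, 0, 1, 1, 1, 1]

/-- The list of 3-subsets of `Fin 6` on which the type-1 chirotope is negative (0-indexed:
`{1,3,4}, {1,3,5}, {1,4,5}, {2,3,5}, {2,4,5}, {3,4,6}, {3,5,6}`). -/
def negSets1 : Finset (Finset (Fin 6)) :=
  {{0, 2, 3}, {0, 2, 4}, {0, 3, 4}, {1, 2, 4}, {1, 3, 4}, {2, 3, 5}, {2, 4, 5}}

/-- Sign pattern for the generic matrix with last columns `(a, b, 1)` and `(c, d, 1)`. -/
lemma signs_aux (a b c d : ℝ) (ha : a < 0) (hb : 1 < b) (hc : 1 < c) (hd : d < 0)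
    (h1 : a * d < b * c) (h2 : (c - 1) * (b - 1) < (1 - d) * (1 - a))
    (i j k : Fin 6) (hij : i < j) (hjk : j < k) :
    if ({i, j, k} : Finset (Fin 6)) ∈ negSets1 then
      minor3 !![1, 0, 0, 1, a, c; 0, 1, 0, 1, b, d; 0, 0, 1, 1, 1, 1] i j k < 0
    else 0 < minor3 !![1, 0, 0, 1, a, c; 0, 1, 0, 1, b, d; 0, 0, 1, 1, 1, 1] i j k := by
  rw [minor3_expand]
  fin_cases i <;> fin_cases j <;> first | (exact absurd hij (by decide)) | skip
  all_goals fin_cases k <;> first | (exact absurd hjk (by decide)) | skip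
  all_goals
    first
    | (rw [if_pos (by decide)]; simp [Matrix.of_apply, Matrix.cons_val]; done)
    | (rw [if_neg (by decide)]; simp [Matrix.of_apply, Matrix.cons_val]; done)
    | (rw [if_pos (by decide)]; simp [Matrix.of_apply, Matrix.cons_val]; linarith)
    | (rw [if_neg (by decide)]; simp [Matrix.of_apply, Matrix.cons_val]; linarith)

/-- For `y` in the positive orthant, all denominators occurring in the entries of `M₁(y)` are
nonzero, and the 20 maximal minors of `M₁(y)` are nonzero with sign pattern realizing the
type-1 chirotope: negative exactly on `negSets1` and positive otherwise. -/
theorem M1_minor_signs (y : Fin 4 → ℝ) (hy : ∀ i, 0 < y i) :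
    (y 2 ≠ 0 ∧ y 1 * y 2 ≠ 0 ∧
      y 0 * y 1 * y 3 + y 1 * y 3 + y 3 + 1 ≠ 0 ∧
      y 1 * y 2 + y 1 * y 2 * y 3 + y 2 * y 3 + y 2 + y 0 * y 1 * y 3 + y 1 * y 3 + y 3 + 1
        ≠ 0) ∧
    (∀ i j k : Fin 6, i < j → j < k →
      if ({i, j, k} : Finset (Fin 6)) ∈ negSets1 then minor3 (M1 y) i j k < 0
      else 0 < minor3 (M1 y) i j k) := by
  have hp := hy 0
  have hq := hy 1
  have hr := hy 2
  have ht := hy 3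
  refine ⟨⟨by positivity, by positivity, by positivity, by positivity⟩, ?_⟩
  unfold M1
  generalize y 0 = p at *
  generalize y 1 = q at *
  generalize y 2 = r at *
  generalize y 3 = t at *
  have hD1 : 0 < p * q * t + q * t + t + 1 := by positivity
  have hD2 : 0 < q * r + q * r * t + r * t + r + p * q * t + q * t + t + 1 := by positivity
  apply signs_aux
  · exact div_neg_of_neg_of_pos (by norm_num) hr
  · rw [lt_div_iff₀ hD1]
    have : 0 < p * q + q := by positivity
    linarith
  · rw [lt_div_iff₀ (by positivity)]
    linarith
  · apply div_neg_of_neg_of_pos _ hD2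
    have : 0 < p * (q * r + r + 1) * (t + 1) := by positivity
    linarith
  · rw [← sub_pos]
    have : (p * q + q + 1) * (t + 1) / (p * q * t + q * t + t + 1) *
        ((q * r + r + 1) / (q * r)) - -1 / r * (-(p * (q * r + r + 1) * (t + 1)) /
        (q * r + q * r * t + r * t + r + p * q * t + q * t + t + 1)) =
        (q * r + r + 1) * (t + 1) * ((q + 1) * (p * q * t + q * t + t + 1) +
          (p * q + q + 1) * (r * (q + 1) * (t + 1))) /
        (q * r * (p * q * t + q * t + t + 1) *
        (q * r + q * r * t + r * t + r + p * q * t + q * t + t + 1)) := by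
      field_simp
      ring
    rw [this]
    positivity
  · rw [← sub_pos]
    have : (1 - -(p * (q * r + r + 1) * (t + 1)) /
        (q * r + q * r * t + r * t + r + p * q * t + q * t + t + 1)) * (1 - -1 / r) -
        ((q * r + r + 1) / (q * r) - 1) *
        ((p * q + q + 1) * (t + 1) / (p * q * t + q * t + t + 1) - 1) =
        (r + 1) * ((q * r + q * r * t + r * t + r + p * q * t + q * t + t + 1) *
          ((p * q + q + 1) * t) + p * ((p * q + q + 1) * t *
          ((q * r + r) * (t + 1) + t) + t)) /
        (r * (p * q * t + q * t + t + 1) *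
        (q * r + q * r * t + r * t + r + p * q * t + q * t + t + 1)) := by
      field_simp
      ring
    rw [this]
    positivity
end
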